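/- arXiv:1308.2998 — 6 statements merged into one kernel-verified Lean document; each statement's English description precedes it below -/
import Mathlib

section
/- Let P be a ℤ^d-invariant algebraic recurrence given by a finite index set 𝒜, finite multisets E_α of elements of ℤ^d and nonzero constants c_α ∈ ℂ, and let ℓ : ℤ^d → ℤ be a linear functional. Suppose δ ≥ 1, P is (δ−1)-homogeneous with respect to ℓ, and, writing ℓ(α) := Σ_{w∈E_α} ℓ(w)^δ, there are at least two distinct integers m for which Σ_{α : ℓ(α)=m} c_α ≠ 0. Then there exists a nonzero complex number γ such that for every monic polynomial q of degree δ with integer coefficients and every v ∈ ℤ^d, the function f(w) = γ^{q(ℓ(w))} satisfies P at v, i.e., Σ_{α∈𝒜} c_α γ^{Σ_{w∈E_α} q(ℓ(v+w))} = 0. In particular f(w) = γ^{ℓ(w)^δ} satisfies P at every v ∈ ℤ^d. -/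
/-- A function `f : ℤ^d → ℂ` satisfies the `ℤ^d`-invariant algebraic recurrence given by
the multisets `E α` and coefficients `c α` at the point `v`. -/
def SatisfiesRecAt {d : ℕ} {A : Type*} [Fintype A]
    (E : A → Multiset (Fin d → ℤ)) (c : A → ℂ) (f : (Fin d → ℤ) → ℂ)
    (v : Fin d → ℤ) : Prop :=
  ∑ α : A, c α * ((E α).map fun w => f (v + w)).prod = 0

/-- The recurrence given by `E` is `k`-homogeneous with respect to the linear
functional `ℓ`. -/
def IsHomogeneousRec {d : ℕ} {A : Type*} [Fintype A]
    (E : A → Multiset (Fin d → ℤ)) (ℓ : (Fin d → ℤ) →ₗ[ℤ] ℤ) (k : ℕ) : Prop :=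
  ∃ β : ℕ → ℤ, ∀ j ≤ k, ∀ α : A, ((E α).map fun w => ℓ w ^ j).sum = β j

open Polynomial in
/-- A complex polynomial with two nonzero coefficients has a nonzero root. -/
theorem exists_ne_zero_root_of_two_coeff_ne_zero {p : ℂ[X]} {a b : ℕ} (hab : a ≠ b)
    (ha : p.coeff a ≠ 0) (hb : p.coeff b ≠ 0) : ∃ z : ℂ, z ≠ 0 ∧ p.eval z = 0 := by
  have hp : p ≠ 0 := by
    rintro rfl
    simp at ha
  by_contra! h
  have hroots : p.roots = Multiset.replicate p.roots.card 0 := by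
    refine Multiset.eq_replicate_card.2 fun z hz => ?_
    by_contra hz0
    exact h z hz0 ((mem_roots hp).1 hz)
  have hprod := (IsAlgClosed.splits p).eq_prod_roots
  rw [hroots] at hprod
  simp only [Multiset.map_replicate, Multiset.prod_replicate, map_zero, sub_zero] at hprod
  rw [hprod, coeff_C_mul_X_pow] at ha hb
  exact hab ((ite_ne_right_iff.1 ha).1.trans (ite_ne_right_iff.1 hb).1.symm)

open Finset Polynomial in
/-- A complex Laurent polynomial with two nonzero coefficients has a nonzero root. -/
theorem exists_ne_zero_sum_mul_zpow_eq_zero {A : Type*} [Fintype A] (c : A → ℂ) (e : A → ℤ)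
    {m₁ m₂ : ℤ} (hm : m₁ ≠ m₂) (h₁ : ∑ α with e α = m₁, c α ≠ 0)
    (h₂ : ∑ α with e α = m₂, c α ≠ 0) :
    ∃ γ : ℂ, γ ≠ 0 ∧ ∑ α, c α * γ ^ e α = 0 := by
  set N : ℤ := ∑ α, |e α|
  have hN (α : A) : 0 ≤ e α + N := by
    have := single_le_sum (f := fun α => |e α|) (fun i _ => abs_nonneg _) (mem_univ α)
    have := neg_abs_le (e α)
    lia
  have hnonneg {m : ℤ} (h : ∑ α with e α = m, c α ≠ 0) : 0 ≤ m + N := by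
    obtain ⟨α, hα, -⟩ := exists_ne_zero_of_sum_ne_zero h
    rw [← (mem_filter.1 hα).2]
    exact hN α
  have hcoeff {m : ℤ} (h : ∑ α with e α = m, c α ≠ 0) :
      (∑ α, C (c α) * X ^ (e α + N).toNat : ℂ[X]).coeff (m + N).toNat ≠ 0 := by
    have hm := hnonneg h
    convert h using 1
    rw [finsetSum_coeff, sum_filter]
    refine sum_congr rfl fun α _ => ?_
    rw [coeff_C_mul_X_pow]
    have := hN α
    exact if_congr (by lia) rfl rfl
  have hne : (m₁ + N).toNat ≠ (m₂ + N).toNat := by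
    have := hnonneg h₁
    have := hnonneg h₂
    lia
  obtain ⟨γ, hγ, hroot⟩ := exists_ne_zero_root_of_two_coeff_ne_zero hne (hcoeff h₁) (hcoeff h₂)
  refine ⟨γ, hγ, (mul_eq_zero.1 ?_).resolve_right (zpow_ne_zero N hγ)⟩
  rw [← hroot, eval_finsetSum, sum_mul]
  refine sum_congr rfl fun α _ => ?_
  rw [eval_mul, eval_C, eval_pow, eval_X, mul_assoc, ← zpow_add₀ hγ, ← zpow_natCast,
    Int.toNat_of_nonneg (hN α)]

open Polynomial in
theorem Multiset.sum_map_eval {R ι : Type*} [CommSemiring R] (s : Multiset ι) (g : ι → R)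
    (p : R[X]) :
    (s.map fun w => p.eval (g w)).sum =
      ∑ j ∈ Finset.range (p.natDegree + 1), p.coeff j * (s.map fun w => g w ^ j).sum := by
  simp only [eval_eq_sum_range, Finset.sum_eq_multiset_sum]
  rw [Multiset.sum_map_sum_map]
  simp only [Multiset.sum_map_mul_left]

theorem Multiset.prod_map_zpow_eq_zpow_sum {G₀ ι : Type*} [CommGroupWithZero G₀] {γ : G₀}
    (hγ : γ ≠ 0) (s : Multiset ι) (g : ι → ℤ) :
    (s.map fun w => γ ^ g w).prod = γ ^ (s.map g).sum := by
  induction s using Multiset.induction with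
  | empty => simp
  | cons a s ih => simp [ih, zpow_add₀ hγ]

open Polynomial in
/-- For a `(δ - 1)`-homogeneous recurrence and a monic `q` of degree `δ`, the exponents obtained
from `q` at `v` differ from the `δ`-th power sums by a constant. -/
theorem IsHomogeneousRec.exists_sum_map_eval_eq {d : ℕ} {A : Type*} [Fintype A]
    {E : A → Multiset (Fin d → ℤ)} {ℓ : (Fin d → ℤ) →ₗ[ℤ] ℤ} {δ : ℕ} (hδ : 1 ≤ δ)
    (hhom : IsHomogeneousRec E ℓ (δ - 1)) {q : ℤ[X]} (hq : q.Monic) (hdeg : q.natDegree = δ)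
    (v : Fin d → ℤ) :
    ∃ K : ℤ, ∀ α, ((E α).map fun w => q.eval (ℓ (v + w))).sum =
      K + ((E α).map fun w => ℓ w ^ δ).sum := by
  obtain ⟨β, hβ⟩ := hhom
  set r : ℤ[X] := q.comp (X + C (ℓ v))
  have hr : r.Monic := hq.comp_X_add_C _
  have hrdeg : r.natDegree = δ := by rw [natDegree_comp, natDegree_X_add_C, hdeg, mul_one]
  refine ⟨∑ j ∈ Finset.range δ, r.coeff j * β j, fun α => ?_⟩
  have heval (w : Fin d → ℤ) : q.eval (ℓ (v + w)) = r.eval (ℓ w) := by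
    simp [r, eval_comp, add_comm]
  have hlead : r.coeff δ = 1 := hrdeg ▸ hr.coeff_natDegree
  simp only [heval]
  rw [Multiset.sum_map_eval, hrdeg, Finset.sum_range_succ, hlead, one_mul]
  congr 1
  refine Finset.sum_congr rfl fun j hj => ?_
  rw [hβ j (by have := Finset.mem_range.1 hj; lia) α]

theorem isotropic_solution_exists {d : ℕ} {A : Type*} [Fintype A] [DecidableEq A]
    (E : A → Multiset (Fin d → ℤ)) (c : A → ℂ) (hc : ∀ α, c α ≠ 0)
    (ℓ : (Fin d → ℤ) →ₗ[ℤ] ℤ) (δ : ℕ) (hδ : 1 ≤ δ)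
    (hhom : IsHomogeneousRec E ℓ (δ - 1))
    (htwo : ∃ m₁ m₂ : ℤ, m₁ ≠ m₂ ∧
      (∑ α ∈ Finset.univ.filter
        (fun α => ((E α).map fun w => ℓ w ^ δ).sum = m₁), c α) ≠ 0 ∧
      (∑ α ∈ Finset.univ.filter
        (fun α => ((E α).map fun w => ℓ w ^ δ).sum = m₂), c α) ≠ 0) :
    ∃ γ : ℂ, γ ≠ 0 ∧
      (∀ q : Polynomial ℤ, q.Monic → q.natDegree = δ → ∀ v : Fin d → ℤ,
        SatisfiesRecAt E c (fun w => γ ^ (Polynomial.eval (ℓ w) q)) v) ∧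
      (∀ v : Fin d → ℤ,
        SatisfiesRecAt E c (fun w => γ ^ ((ℓ w ^ δ : ℤ))) v) := by
  obtain ⟨m₁, m₂, hm, h₁, h₂⟩ := htwo
  obtain ⟨γ, hγ, hsum⟩ := exists_ne_zero_sum_mul_zpow_eq_zero c
    (fun α => ((E α).map fun w => ℓ w ^ δ).sum) hm h₁ h₂
  have hsat (q : Polynomial ℤ) (hq : q.Monic) (hdeg : q.natDegree = δ) (v : Fin d → ℤ) :
      SatisfiesRecAt E c (fun w => γ ^ (Polynomial.eval (ℓ w) q)) v := by
    obtain ⟨K, hK⟩ := hhom.exists_sum_map_eval_eq hδ hq hdeg v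
    simp only [SatisfiesRecAt, Multiset.prod_map_zpow_eq_zpow_sum hγ, hK, zpow_add₀ hγ,
      mul_left_comm _ (γ ^ K)]
    rw [← Finset.mul_sum, hsum, mul_zero]
  refine ⟨γ, hγ, hsat, fun v => ?_⟩
  simpa using hsat (Polynomial.X ^ δ) (Polynomial.monic_X_pow δ) (Polynomial.natDegree_X_pow δ) v
end

section
/- Let A, B : ℕ → ℝ be sequences of positive real numbers, and define h, h⁽ˣ⁾, h⁽ʸ⁾, h⁽ᶻ⁾ on {v ∈ ℤ³ : v₁+v₂+v₃ ≥ 0} by h(v) = A_{v₁+v₂+v₃} and h⁽ˣ⁾(v) = h⁽ʸ⁾(v) = h⁽ᶻ⁾(v) = B_{v₁+v₂+v₃}. Then h, h⁽ˣ⁾, h⁽ʸ⁾, h⁽ᶻ⁾ satisfy the hexahedron recurrence at every v with v₁+v₂+v₃ ≥ 0 if and only if A and B satisfy the scalar isotropic recurrences: B_n·A_{n−1}·B_{n−1} = A_n³ + A_{n−1}A_nA_{n+1} + B_{n−1}³ for all n ≥ 1, and A_n·A_{n−3}²·B_{n−3}³ = 2A_{n−2}³B_{n−3}³ + 3A_{n−3}A_{n−1}A_{n−2}B_{n−3}³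 + A_{n−2}⁶ + 3A_{n−3}A_{n−1}A_{n−2}⁴ + 3A_{n−3}²A_{n−1}²A_{n−2}² + A_{n−3}³A_{n−1}³ + B_{n−3}⁶ for all n ≥ 3. -/
/-- The hexahedron recurrence for functions `h, hx, hy, hz : ℤ³ → K` at the point `(i,j,k)`. -/
def HexRec {K : Type*} [CommRing K] (h hx hy hz : ℤ × ℤ × ℤ → K) : ℤ × ℤ × ℤ → Prop
  | (i, j, k) =>
    hx (i + 1, j, k) * hx (i, j, k) * h (i, j, k)
        = hx (i, j, k) * hy (i, j, k) * hz (i, j, k)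
          + h (i + 1, j, k) * h (i, j + 1, k) * h (i, j, k + 1)
          + h (i, j, k) * h (i + 1, j, k) * h (i, j + 1, k + 1)
    ∧ hy (i, j + 1, k) * hy (i, j, k) * h (i, j, k)
        = hx (i, j, k) * hy (i, j, k) * hz (i, j, k)
          + h (i + 1, j, k) * h (i, j + 1, k) * h (i, j, k + 1)
          + h (i, j, k) * h (i, j + 1, k) * h (i + 1, j, k + 1)
    ∧ hz (i, j, k + 1) * hz (i, j, k) * h (i, j, k)
        = hx (i, j, k) * hy (i, j, k) * hz (i, j, k)
          + h (i + 1, j, k) * h (i, j + 1, k) * h (i, j, k + 1)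
          + h (i, j, k) * h (i, j, k + 1) * h (i + 1, j + 1, k)
    ∧ h (i + 1, j + 1, k + 1) * h (i, j, k) ^ 2 *
          (hx (i, j, k) * hy (i, j, k) * hz (i, j, k))
        = (hx (i, j, k) * hy (i, j, k) * hz (i, j, k)) ^ 2
          + hx (i, j, k) * hy (i, j, k) * hz (i, j, k) *
            (2 * (h (i + 1, j, k) * h (i, j + 1, k) * h (i, j, k + 1))
              + h (i, j, k) * h (i + 1, j, k) * h (i, j + 1, k + 1)
              + h (i, j, k) * h (i, j + 1, k) * h (i + 1, j, k + 1)
              + h (i, j, k) * h (i, j, k + 1) * h (i + 1, j + 1, k))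
          + (h (i + 1, j, k) * h (i, j + 1, k) + h (i, j, k) * h (i + 1, j + 1, k)) *
            (h (i + 1, j, k) * h (i, j, k + 1) + h (i, j, k) * h (i + 1, j, k + 1)) *
            (h (i, j + 1, k) * h (i, j, k + 1) + h (i, j, k) * h (i, j + 1, k + 1))

/-- The scalar isotropic hexahedron recurrences for sequences `A`, `B` of positive reals:
`A n` is the common value at integer points of level `n`, `B n` the common value at the
face points of level `n+1`. -/
def IsotropicHexRec (A B : ℕ → ℝ) : Prop :=
  (∀ n : ℕ, 1 ≤ n →
    B n * A (n - 1) * B (n - 1) = A n ^ 3 + A (n - 1) * A n * A (n + 1) + B (n - 1) ^ 3) ∧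
  (∀ n : ℕ, 3 ≤ n →
    A n * A (n - 3) ^ 2 * B (n - 3) ^ 3
      = 2 * A (n - 2) ^ 3 * B (n - 3) ^ 3
        + 3 * A (n - 3) * A (n - 1) * A (n - 2) * B (n - 3) ^ 3
        + A (n - 2) ^ 6
        + 3 * A (n - 3) * A (n - 1) * A (n - 2) ^ 4
        + 3 * A (n - 3) ^ 2 * A (n - 1) ^ 2 * A (n - 2) ^ 2
        + A (n - 3) ^ 3 * A (n - 1) ^ 3
        + B (n - 3) ^ 6)

/-- For functions depending only on the level `i + j + k`, the hexahedron recurrence at a point of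
level `n` amounts to two scalar equations relating levels `n` to `n + 3`. -/
theorem hexRec_iff_of_level {K : Type*} [CommRing K] (A B : ℕ → K)
    (h hx hy hz : ℤ × ℤ × ℤ → K)
    (hh : ∀ v : ℤ × ℤ × ℤ, 0 ≤ v.1 + v.2.1 + v.2.2 → h v = A (v.1 + v.2.1 + v.2.2).toNat)
    (hhx : ∀ v : ℤ × ℤ × ℤ, 0 ≤ v.1 + v.2.1 + v.2.2 → hx v = B (v.1 + v.2.1 + v.2.2).toNat)
    (hhy : ∀ v : ℤ × ℤ × ℤ, 0 ≤ v.1 + v.2.1 + v.2.2 → hy v = B (v.1 + v.2.1 + v.2.2).toNat)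
    (hhz : ∀ v : ℤ × ℤ × ℤ, 0 ≤ v.1 + v.2.1 + v.2.2 → hz v = B (v.1 + v.2.1 + v.2.2).toNat)
    {i j k : ℤ} {n : ℕ} (hn : i + j + k = n) :
    HexRec h hx hy hz (i, j, k) ↔
      B (n + 1) * A n * B n = A (n + 1) ^ 3 + A n * A (n + 1) * A (n + 2) + B n ^ 3 ∧
      A (n + 3) * A n ^ 2 * B n ^ 3
        = 2 * A (n + 1) ^ 3 * B n ^ 3
          + 3 * A n * A (n + 2) * A (n + 1) * B n ^ 3
          + A (n + 1) ^ 6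
          + 3 * A n * A (n + 2) * A (n + 1) ^ 4
          + 3 * A n ^ 2 * A (n + 2) ^ 2 * A (n + 1) ^ 2
          + A n ^ 3 * A (n + 2) ^ 3
          + B n ^ 6 := by
  have level {f : ℤ × ℤ × ℤ → K} {F : ℕ → K}
      (hf : ∀ v : ℤ × ℤ × ℤ, 0 ≤ v.1 + v.2.1 + v.2.2 → f v = F (v.1 + v.2.1 + v.2.2).toNat)
      (a b c : ℤ) (m : ℕ) (hm : a + b + c = m) : f (a, b, c) = F m := by
    simp [hf (a, b, c) (by simp [hm]), hm]
  simp only [HexRec]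
  rw [level hh i j k n hn, level hhx i j k n hn, level hhy i j k n hn, level hhz i j k n hn,
    level hh (i + 1) j k (n + 1) (by lia), level hh i (j + 1) k (n + 1) (by lia),
    level hh i j (k + 1) (n + 1) (by lia),
    level hh i (j + 1) (k + 1) (n + 2) (by lia), level hh (i + 1) j (k + 1) (n + 2) (by lia),
    level hh (i + 1) (j + 1) k (n + 2) (by lia),
    level hh (i + 1) (j + 1) (k + 1) (n + 3) (by lia),
    level hhx (i + 1) j k (n + 1) (by lia), level hhy i (j + 1) k (n + 1) (by lia),
    level hhz i j (k + 1) (n + 1) (by lia)]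
  constructor
  · rintro ⟨h₁, -, -, h₂⟩
    constructor
    · linear_combination h₁
    · linear_combination h₂
  · rintro ⟨h₁, h₂⟩
    refine ⟨?_, ?_, ?_, ?_⟩
    · linear_combination h₁
    · linear_combination h₁
    · linear_combination h₁
    · linear_combination h₂

theorem isotropic_hexahedron_iff
    (A B : ℕ → ℝ) (hA : ∀ n, 0 < A n) (hB : ∀ n, 0 < B n)
    (h hx hy hz : ℤ × ℤ × ℤ → ℝ)
    (hh : ∀ v : ℤ × ℤ × ℤ, 0 ≤ v.1 + v.2.1 + v.2.2 → h v = A (v.1 + v.2.1 + v.2.2).toNat)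
    (hhx : ∀ v : ℤ × ℤ × ℤ, 0 ≤ v.1 + v.2.1 + v.2.2 → hx v = B (v.1 + v.2.1 + v.2.2).toNat)
    (hhy : ∀ v : ℤ × ℤ × ℤ, 0 ≤ v.1 + v.2.1 + v.2.2 → hy v = B (v.1 + v.2.1 + v.2.2).toNat)
    (hhz : ∀ v : ℤ × ℤ × ℤ, 0 ≤ v.1 + v.2.1 + v.2.2 → hz v = B (v.1 + v.2.1 + v.2.2).toNat) :
    (∀ v : ℤ × ℤ × ℤ, 0 ≤ v.1 + v.2.1 + v.2.2 → HexRec h hx hy hz v)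
      ↔ IsotropicHexRec A B := by
  have key {i j k : ℤ} {n : ℕ} (hn : i + j + k = n) :=
    hexRec_iff_of_level A B h hx hy hz hh hhx hhy hhz hn
  constructor
  · intro H
    have scalar (n : ℕ) := (key (i := n) (j := 0) (k := 0) (n := n) (by simp)).1 (H _ (by simp))
    constructor
    · intro n hn
      obtain ⟨m, rfl⟩ := Nat.exists_eq_add_of_le' hn
      exact (scalar m).1
    · intro n hn
      obtain ⟨m, rfl⟩ := Nat.exists_eq_add_of_le' hn
      exact (scalar m).2
  · rintro ⟨h₁, h₂⟩ ⟨i, j, k⟩ hv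
    obtain ⟨n, hn⟩ := Int.eq_ofNat_of_zero_le hv
    exact (key hn).2 ⟨h₁ (n + 1) (by lia), h₂ (n + 3) (by lia)⟩
end

section
/- Let A, B : ℕ → ℝ be sequences of positive real numbers satisfying the scalar isotropic hexahedron recurrences: B_n·A_{n−1}·B_{n−1} = A_n³ + A_{n−1}A_nA_{n+1} + B_{n−1}³ for all n ≥ 1, and A_n·A_{n−3}²·B_{n−3}³ = 2A_{n−2}³B_{n−3}³ + 3A_{n−3}A_{n−1}A_{n−2}B_{n−3}³ + A_{n−2}⁶ + 3A_{n−3}A_{n−1}A_{n−2}⁴ + 3A_{n−3}²A_{n−1}²A_{n−2}² + A_{n−3}³A_{n−1}³ + B_{n−3}⁶ for all n ≥ 3. Then for every n ≥ 0: A_{2n} = A₀^{(n−1)²}·A₃^{n²−n}·A₁^{−(n²−n)}·A₂^{−(n²−2n)}, A_{2n+1} = A₀^{n²−n}·A₃^{n²}·A₁^{−(n²−1)}·A₂^{−(n²−n)}, B_{2n} = A₀^{n²−n}·B₂^{n²}·A₂^{−(n²−n)}·B₀^{−(n²−1)}, and B_{2n+1} = A₀^{n²}·B₁·B₂^{n²+n}·A₂^{−n²}·B₀^{−(n²+n)}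 (all powers being integer powers of positive reals, possibly negative). -/
namespace IsotropicHexRec

variable {A B : ℕ → ℝ}

theorem mul_cube_add_cube (hA : ∀ n, 0 < A n) (hB : ∀ n, 0 < B n)
    (hrec : IsotropicHexRec A B) (n : ℕ) :
    A (n + 3) * (A (n + 1) ^ 3 + B n ^ 3) = A n * (A (n + 2) ^ 3 + B (n + 1) ^ 3) := by
  have h₁ : B (n + 1) * A n * B n = A (n + 1) ^ 3 + A n * A (n + 1) * A (n + 2) + B n ^ 3 :=
    hrec.1 (n + 1) (by omega)
  have h₂ := hrec.2 (n + 3) (by omega)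
  simp only [show n + 3 - 3 = n by omega, show n + 3 - 2 = n + 1 by omega,
    show n + 3 - 1 = n + 2 by omega] at h₂
  have ha := (hA n).ne'
  have hd := (hB n).ne'
  have hB₁ : B (n + 1)
      = (A (n + 1) ^ 3 + A n * A (n + 1) * A (n + 2) + B n ^ 3) / (A n * B n) := by
    rw [eq_div_iff (mul_ne_zero ha hd), ← h₁]
    ring
  have hA₃ := eq_div_of_mul_eq (mul_ne_zero (pow_ne_zero 2 ha) (pow_ne_zero 3 hd))
    ((mul_assoc _ _ _).symm.trans h₂)
  rw [hA₃, hB₁]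
  field_simp
  ring

theorem mul_eq_mul (hA : ∀ n, 0 < A n) (hB : ∀ n, 0 < B n)
    (hrec : IsotropicHexRec A B) (n : ℕ) :
    A (n + 1) * B (n + 2) = A (n + 3) * B n := by
  have h₀ : B (n + 1) * A n * B n = A (n + 1) ^ 3 + A n * A (n + 1) * A (n + 2) + B n ^ 3 :=
    hrec.1 (n + 1) (by omega)
  have h₁ : B (n + 2) * A (n + 1) * B (n + 1)
      = A (n + 2) ^ 3 + A (n + 1) * A (n + 2) * A (n + 3) + B (n + 1) ^ 3 :=
    hrec.1 (n + 2) (by omega)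
  have h₂ := mul_cube_add_cube hA hB hrec n
  refine mul_left_cancel₀ (mul_pos (hA n) (hB (n + 1))).ne' ?_
  linear_combination A n * h₁ - h₂ - A (n + 3) * h₀

theorem mul_sq_eq (hA : ∀ n, 0 < A n) (hB : ∀ n, 0 < B n)
    (hrec : IsotropicHexRec A B) (n : ℕ) :
    A (n + 4) * A (n + 1) ^ 2 = A n * A (n + 3) ^ 2 := by
  have h₀ := mul_cube_add_cube hA hB hrec n
  have h₁ : A (n + 4) * (A (n + 2) ^ 3 + B (n + 1) ^ 3)
      = A (n + 1) * (A (n + 3) ^ 3 + B (n + 2) ^ 3) := mul_cube_add_cube hA hB hrec (n + 1)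
  have h₂ : A (n + 1) ^ 3 * B (n + 2) ^ 3 = A (n + 3) ^ 3 * B n ^ 3 := by
    rw [← mul_pow, ← mul_pow, mul_eq_mul hA hB hrec n]
  refine mul_right_cancel₀
    (add_pos (pow_pos (hA (n + 2)) 3) (pow_pos (hB (n + 1)) 3)).ne' ?_
  linear_combination A (n + 1) ^ 2 * h₁ + h₂ + A (n + 3) ^ 2 * h₀

theorem log_B_add_two (hA : ∀ n, 0 < A n) (hB : ∀ n, 0 < B n)
    (hrec : IsotropicHexRec A B) (n : ℕ) :
    Real.log (B (n + 2)) + Real.log (A (n + 1)) = Real.log (B n) + Real.log (A (n + 3)) := by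
  have h := congrArg Real.log (mul_eq_mul hA hB hrec n)
  rw [Real.log_mul (hA _).ne' (hB _).ne', Real.log_mul (hA _).ne' (hB _).ne'] at h
  linear_combination h

theorem log_A_add_three (hA : ∀ n, 0 < A n) (hB : ∀ n, 0 < B n)
    (hrec : IsotropicHexRec A B) (n : ℕ) :
    Real.log (A (n + 3)) + Real.log (A n) = Real.log (A (n + 1)) + Real.log (A (n + 2))
      + (Real.log (A 0) + Real.log (A 3) - Real.log (A 1) - Real.log (A 2)) := by
  induction n with
  | zero => simp only [zero_add]; ring
  | succ n ih =>
    have h := congrArg Real.log (mul_sq_eq hA hB hrec n)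
    rw [Real.log_mul (hA _).ne' (pow_pos (hA _) 2).ne',
      Real.log_mul (hA _).ne' (pow_pos (hA _) 2).ne', Real.log_pow, Real.log_pow] at h
    push_cast at h
    rw [show n + 1 + 3 = n + 4 by omega, show n + 1 + 1 = n + 2 by omega,
      show n + 1 + 2 = n + 3 by omega]
    linear_combination h + ih

theorem log_B_add_three (hA : ∀ n, 0 < A n) (hB : ∀ n, 0 < B n)
    (hrec : IsotropicHexRec A B) (n : ℕ) :
    Real.log (B (n + 3)) + Real.log (B n) = Real.log (B (n + 1)) + Real.log (B (n + 2))
      + (Real.log (A 0) + Real.log (B 2) - Real.log (A 2) - Real.log (B 0)) := by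
  have h₀ := log_B_add_two hA hB hrec 0
  have h₁ := log_B_add_two hA hB hrec n
  have h₂ := log_B_add_two hA hB hrec (n + 1)
  have h₃ := log_A_add_three hA hB hrec (n + 1)
  simp only [zero_add, add_assoc, Nat.reduceAdd] at h₀ h₁ h₂ h₃ ⊢
  linear_combination h₂ - h₁ + h₃ - h₀

end IsotropicHexRec

theorem even_odd_of_add_three {L : ℕ → ℝ} {c : ℝ}
    (h : ∀ n, L (n + 3) + L n = L (n + 1) + L (n + 2) + c) (n : ℕ) :
    L (2 * n) = L 0 + n * (L 2 - L 0) + c * (n * (n - 1)) ∧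
      L (2 * n + 1) = L 1 + n * (L 2 - L 0) + c * n ^ 2 := by
  have step (m : ℕ) : L (m + 2) = L m + (L 2 - L 0) + m * c := by
    induction m with
    | zero => simp
    | succ m ih =>
      have := h m
      rw [show m + 1 + 2 = m + 3 by omega]
      push_cast
      linear_combination this + ih
  induction n with
  | zero => simp
  | succ n ih =>
    have h₀ := step (2 * n)
    have h₁ := step (2 * n + 1)
    rw [show 2 * (n + 1) + 1 = 2 * n + 1 + 2 by omega, show 2 * (n + 1) = 2 * n + 2 by omega]
    push_cast at h₀ h₁ ⊢
    exact ⟨by linear_combination h₀ + ih.1, by linear_combination h₁ + ih.2⟩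

theorem isotropic_hexahedron_solution
    (A B : ℕ → ℝ) (hA : ∀ n, 0 < A n) (hB : ∀ n, 0 < B n)
    (hrec : IsotropicHexRec A B) :
    ∀ n : ℕ,
      A (2 * n) = A 0 ^ (((n : ℤ) - 1) ^ 2) * A 3 ^ ((n : ℤ) ^ 2 - n)
          * A 1 ^ (-((n : ℤ) ^ 2 - n)) * A 2 ^ (-((n : ℤ) ^ 2 - 2 * n))
      ∧ A (2 * n + 1) = A 0 ^ ((n : ℤ) ^ 2 - n) * A 3 ^ ((n : ℤ) ^ 2)
          * A 1 ^ (-((n : ℤ) ^ 2 - 1)) * A 2 ^ (-((n : ℤ) ^ 2 - n))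
      ∧ B (2 * n) = A 0 ^ ((n : ℤ) ^ 2 - n) * B 2 ^ ((n : ℤ) ^ 2)
          * A 2 ^ (-((n : ℤ) ^ 2 - n)) * B 0 ^ (-((n : ℤ) ^ 2 - 1))
      ∧ B (2 * n + 1) = A 0 ^ ((n : ℤ) ^ 2) * B 1 * B 2 ^ ((n : ℤ) ^ 2 + n)
          * A 2 ^ (-((n : ℤ) ^ 2)) * B 0 ^ (-((n : ℤ) ^ 2 + n)) := by
  intro n
  obtain ⟨hA₀, hA₁⟩ := even_odd_of_add_three (L := fun n => Real.log (A n))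
    (hrec.log_A_add_three hA hB) n
  obtain ⟨hB₀, hB₁⟩ := even_odd_of_add_three (L := fun n => Real.log (B n))
    (hrec.log_B_add_three hA hB) n
  have hA_ne (i : ℕ) (k : ℤ) : A i ^ k ≠ 0 := zpow_ne_zero k (hA i).ne'
  have hB_ne (i : ℕ) (k : ℤ) : B i ^ k ≠ 0 := zpow_ne_zero k (hB i).ne'
  have hB₁_ne : B 1 ≠ 0 := (hB 1).ne'
  have := hA 0
  have := hA 1
  have := hA 2
  have := hA 3
  have := hB 0
  have := hB 1
  have := hB 2
  have eq_of_log_eq {x y : ℝ} (hx : 0 < x) (hy : 0 < y) (h : Real.log x = Real.log y) : x = y :=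
    Real.log_injOn_pos hx hy h
  refine ⟨eq_of_log_eq (hA _) (by positivity) ?_, eq_of_log_eq (hA _) (by positivity) ?_,
      eq_of_log_eq (hB _) (by positivity) ?_, eq_of_log_eq (hB _) (by positivity) ?_⟩ <;>
    simp only [Real.log_mul, ne_eq, mul_eq_zero, hA_ne, hB_ne, hB₁_ne, or_self,
      not_false_eq_true, Real.log_zpow] <;>
    push_cast
  · linear_combination hA₀
  · linear_combination hA₁
  · linear_combination hB₀
  · linear_combination hB₁
end

section
/- Define h, h⁽ˣ⁾, h⁽ʸ⁾, h⁽ᶻ⁾ : ℤ³ → ℝ by h(v) = 3^{n²/2} and h⁽ˣ⁾(v) = h⁽ʸ⁾(v) = h⁽ᶻ⁾(v) = 2·3^{(n+1)²/2}, where n = v₁+v₂+v₃ (real powers of 3). Then h, h⁽ˣ⁾, h⁽ʸ⁾, h⁽ᶻ⁾ satisfy the hexahedron recurrence at every v ∈ ℤ³. -/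
/-- The values of `x ↦ 3 ^ (x ^ 2 / 2)` at `x` and `x + 2` multiply to three times the square of
its value at `x + 1`. -/
theorem three_rpow_half_sq_mul_add_two (x : ℝ) :
    (3 : ℝ) ^ (x ^ 2 / 2) * (3 : ℝ) ^ ((x + 2) ^ 2 / 2) =
      3 * ((3 : ℝ) ^ ((x + 1) ^ 2 / 2)) ^ 2 := by
  rw [← Real.rpow_add three_pos, ← Real.rpow_mul_natCast three_pos.le]
  nth_rewrite 2 [← Real.rpow_one 3]
  rw [← Real.rpow_add three_pos]
  congr 1
  push_cast
  ring

/-- The value of `x ↦ 3 ^ (x ^ 2 / 2)` at `x + 3` times the square of its value at `x` is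
`27` times the cube of its value at `x + 1`. -/
theorem three_rpow_half_sq_add_three_mul_sq (x : ℝ) :
    (3 : ℝ) ^ ((x + 3) ^ 2 / 2) * ((3 : ℝ) ^ (x ^ 2 / 2)) ^ 2 =
      27 * ((3 : ℝ) ^ ((x + 1) ^ 2 / 2)) ^ 3 := by
  have h27 : (27 : ℝ) = (3 : ℝ) ^ (3 : ℝ) := by norm_num
  rw [h27, ← Real.rpow_mul_natCast three_pos.le, ← Real.rpow_mul_natCast three_pos.le,
    ← Real.rpow_add three_pos, ← Real.rpow_add three_pos]
  congr 1
  push_cast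
  ring

theorem isotropic_power_of_three_solves_hexahedron
    (h hx hy hz : ℤ × ℤ × ℤ → ℝ)
    (hh : ∀ v : ℤ × ℤ × ℤ, h v = (3 : ℝ) ^ ((((v.1 + v.2.1 + v.2.2 : ℤ) : ℝ)) ^ 2 / 2))
    (hhx : ∀ v : ℤ × ℤ × ℤ,
      hx v = 2 * (3 : ℝ) ^ ((((v.1 + v.2.1 + v.2.2 : ℤ) : ℝ) + 1) ^ 2 / 2))
    (hhy : ∀ v : ℤ × ℤ × ℤ,
      hy v = 2 * (3 : ℝ) ^ ((((v.1 + v.2.1 + v.2.2 : ℤ) : ℝ) + 1) ^ 2 / 2))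
    (hhz : ∀ v : ℤ × ℤ × ℤ,
      hz v = 2 * (3 : ℝ) ^ ((((v.1 + v.2.1 + v.2.2 : ℤ) : ℝ) + 1) ^ 2 / 2)) :
    ∀ v : ℤ × ℤ × ℤ, HexRec h hx hy hz v := by
  rintro ⟨i, j, k⟩
  obtain ⟨x, hx0⟩ : ∃ x : ℝ, x = ((i + j + k : ℤ) : ℝ) := ⟨_, rfl⟩
  have e100 : ((i + 1 + j + k : ℤ) : ℝ) = x + 1 := by rw [hx0]; push_cast; ring
  have e010 : ((i + (j + 1) + k : ℤ) : ℝ) = x + 1 := by rw [hx0]; push_cast; ring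
  have e001 : ((i + j + (k + 1) : ℤ) : ℝ) = x + 1 := by rw [hx0]; push_cast; ring
  have e110 : ((i + 1 + (j + 1) + k : ℤ) : ℝ) = x + 2 := by rw [hx0]; push_cast; ring
  have e101 : ((i + 1 + j + (k + 1) : ℤ) : ℝ) = x + 2 := by rw [hx0]; push_cast; ring
  have e011 : ((i + (j + 1) + (k + 1) : ℤ) : ℝ) = x + 2 := by rw [hx0]; push_cast; ring
  have e111 : ((i + 1 + (j + 1) + (k + 1) : ℤ) : ℝ) = x + 3 := by rw [hx0]; push_cast; ring
  have e2 : x + 1 + 1 = x + 2 := by ring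
  simp only [HexRec, hh, hhx, hhy, hhz, e100, e010, e001, e110, e101, e011, e111, ← hx0, e2]
  have hac := three_rpow_half_sq_mul_add_two x
  have hda := three_rpow_half_sq_add_three_mul_sq x
  generalize (3 : ℝ) ^ (x ^ 2 / 2) = a at *
  generalize (3 : ℝ) ^ ((x + 1) ^ 2 / 2) = b at *
  generalize (3 : ℝ) ^ ((x + 2) ^ 2 / 2) = c at *
  generalize (3 : ℝ) ^ ((x + 3) ^ 2 / 2) = d at *
  refine ⟨?_, ?_, ?_, ?_⟩
  · linear_combination 3 * b * hac
  · linear_combination 3 * b * hac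
  · linear_combination 3 * b * hac
  · rw [hda]
    have hbac : b * b + a * c = 4 * b ^ 2 := by linear_combination hac
    rw [hbac]
    linear_combination -24 * b ^ 4 * hac
end

section
/- Define sequences A, B : ℕ → ℝ by A_{2n} = 14^{n(n−1)}, A_{2n+1} = 14^{n²}, B_{2n} = 14^{n²}, B_{2n+1} = 3·14^{n(n+1)}. Then A₀ = A₁ = A₂ = B₀ = 1, and A, B satisfy the scalar isotropic hexahedron recurrences: B_n·A_{n−1}·B_{n−1} = A_n³ + A_{n−1}A_nA_{n+1} + B_{n−1}³ for all n ≥ 1, and A_n·A_{n−3}²·B_{n−3}³ = 2A_{n−2}³B_{n−3}³ + 3A_{n−3}A_{n−1}A_{n−2}B_{n−3}³ + A_{n−2}⁶ + 3A_{n−3}A_{n−1}A_{n−2}⁴ + 3A_{n−3}²A_{n−1}²A_{n−2}² + A_{n−3}³A_{n−1}³ + B_{n−3}⁶ for all n ≥ 3. -/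
theorem fourteen_power_solution
    (A B : ℕ → ℝ)
    (hAeven : ∀ n : ℕ, A (2 * n) = (14 : ℝ) ^ (n * (n - 1)))
    (hAodd : ∀ n : ℕ, A (2 * n + 1) = (14 : ℝ) ^ (n ^ 2))
    (hBeven : ∀ n : ℕ, B (2 * n) = (14 : ℝ) ^ (n ^ 2))
    (hBodd : ∀ n : ℕ, B (2 * n + 1) = 3 * (14 : ℝ) ^ (n * (n + 1))) :
    A 0 = 1 ∧ A 1 = 1 ∧ A 2 = 1 ∧ B 0 = 1 ∧ IsotropicHexRec A B := by
  have param : ∀ m : ℕ, ∃ z x : ℝ, A (2 * m) = z ∧ A (2 * m + 1) = z * x ∧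
      A (2 * m + 2) = z * x ^ 2 ∧ A (2 * m + 3) = 14 * z * x ^ 3 ∧
      A (2 * m + 4) = 196 * z * x ^ 4 ∧ B (2 * m) = z * x ∧
      B (2 * m + 1) = 3 * z * x ^ 2 ∧ B (2 * m + 2) = 14 * z * x ^ 3 := by
    intro m
    have hsq : m ^ 2 = m * (m - 1) + m := by
      cases m with
      | zero => rfl
      | succ k => simp only [Nat.add_sub_cancel]; ring
    have hy : (14 : ℝ) ^ (m ^ 2) = 14 ^ (m * (m - 1)) * 14 ^ m := by rw [hsq, pow_add]
    refine ⟨14 ^ (m * (m - 1)), 14 ^ m, hAeven m, (hAodd m).trans hy, ?_, ?_, ?_,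
      (hBeven m).trans hy, ?_, ?_⟩
    · rw [show 2 * m + 2 = 2 * (m + 1) by ring, hAeven, Nat.add_sub_cancel,
        show (m + 1) * m = m ^ 2 + m by ring, pow_add, hy]
      ring
    · rw [show 2 * m + 3 = 2 * (m + 1) + 1 by ring, hAodd,
        show (m + 1) ^ 2 = m ^ 2 + m + m + 1 by ring]
      simp only [pow_add, hy]
      ring
    · rw [show 2 * m + 4 = 2 * (m + 2) by ring, hAeven, show m + 2 - 1 = m + 1 by omega,
        show (m + 2) * (m + 1) = m ^ 2 + m + m + m + 2 by ring]
      simp only [pow_add, hy]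
      ring
    · rw [hBodd, show m * (m + 1) = m ^ 2 + m by ring, pow_add, hy]
      ring
    · rw [show 2 * m + 2 = 2 * (m + 1) by ring, hBeven,
        show (m + 1) ^ 2 = m ^ 2 + m + m + 1 by ring]
      simp only [pow_add, hy]
      ring
  refine ⟨by simpa using hAeven 0, by simpa using hAodd 0, by simpa using hAeven 1,
    by simpa using hBeven 0, fun n hn => ?_, fun n hn => ?_⟩
  · obtain ⟨k, rfl⟩ := Nat.exists_eq_add_of_le' hn
    rw [Nat.add_sub_cancel]
    obtain ⟨m, rfl | rfl⟩ := Nat.even_or_odd' k <;>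
      obtain ⟨z, x, a0, a1, a2, a3, -, b0, b1, b2⟩ := param m
    · rw [a0, a1, a2, b0, b1]
      ring
    · rw [a1, a2, a3, b1, b2]
      ring
  · obtain ⟨k, rfl⟩ := Nat.exists_eq_add_of_le' hn
    rw [Nat.add_sub_cancel, show k + 3 - 2 = k + 1 by omega, show k + 3 - 1 = k + 2 by omega]
    obtain ⟨m, rfl | rfl⟩ := Nat.even_or_odd' k <;>
      obtain ⟨z, x, a0, a1, a2, a3, a4, b0, b1, -⟩ := param m
    · rw [a0, a1, a2, a3, b0]
      ring
    · rw [a1, a2, a3, a4, b1]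
      ring
end

section
/- Let a, b, c be positive real numbers, set R := ac/b² and S := (2(R+1)^{3/2} + 3R + 2)/R², and define f : ℕ → ℝ by f_n = a^{1−n}·b^n·R^{⌊n²/4⌋}·S^{⌊(n−1)²/4⌋} (integer powers of positive reals). Then f₀ = a, f₁ = b, f₂ = c, and for every n ≥ 0, f_{n+3} = (2f_{n+1}³ + 3f_n f_{n+1} f_{n+2} + 2√(f_{n+1}⁶ + 3f_n f_{n+2} f_{n+1}⁴ + 3f_n² f_{n+2}² f_{n+1}² + f_n³ f_{n+2}³)) / f_n². -/
theorem sq_div_four_add_of_even {n : ℕ} (hn : Even n) :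
    n ^ 2 / 4 + (n + 2) ^ 2 / 4 = 2 * ((n + 1) ^ 2 / 4) + 1 := by
  obtain ⟨k, rfl⟩ := hn
  have h0 : (k + k) ^ 2 / 4 = k ^ 2 := by ring_nf; omega
  have h1 : (k + k + 1) ^ 2 / 4 = k ^ 2 + k := by ring_nf; omega
  have h2 : (k + k + 2) ^ 2 / 4 = (k + 1) ^ 2 := by ring_nf; omega
  rw [h0, h1, h2]
  ring

theorem sq_div_four_add_of_odd {n : ℕ} (hn : Odd n) :
    n ^ 2 / 4 + (n + 2) ^ 2 / 4 = 2 * ((n + 1) ^ 2 / 4) := by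
  obtain ⟨k, rfl⟩ := hn
  have h0 : (2 * k + 1) ^ 2 / 4 = k ^ 2 + k := by ring_nf; omega
  have h1 : (2 * k + 1 + 1) ^ 2 / 4 = (k + 1) ^ 2 := by ring_nf; omega
  have h2 : (2 * k + 1 + 2) ^ 2 / 4 = k ^ 2 + 3 * k + 2 := by ring_nf; omega
  rw [h0, h1, h2]
  ring

theorem zpow_one_sub_mul_pow_mul_eq_sq {a : ℝ} (ha : a ≠ 0) (b : ℝ) (n : ℕ) :
    (a ^ ((1 : ℤ) - n) * b ^ n) * (a ^ ((1 : ℤ) - (n + 2 : ℕ)) * b ^ (n + 2))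
      = (a ^ ((1 : ℤ) - (n + 1 : ℕ)) * b ^ (n + 1)) ^ 2 := by
  have h : a ^ ((1 : ℤ) - n) * a ^ ((1 : ℤ) - (n + 2 : ℕ))
      = (a ^ ((1 : ℤ) - (n + 1 : ℕ))) ^ 2 := by
    rw [sq, ← zpow_add₀ ha, ← zpow_add₀ ha]
    congr 1
    push_cast
    ring
  rw [mul_pow, ← h]
  ring

/-- If consecutive ratios `x z / y ^ 2` and `y w / z ^ 2` are `Q` and `Q'`, the isotropic
recurrence reduces to a relation between `Q` and `Q'`. -/
theorem isotropic_step {x y z w Q Q' : ℝ} (hx : 0 < x) (hy : 0 < y) (hQ : 0 < Q)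
    (hxz : x * z = Q * y ^ 2) (hyw : y * w = Q' * z ^ 2)
    (hQQ' : Q' * Q ^ 2 = 2 + 3 * Q + 2 * √(Q + 1) ^ 3) :
    w = (2 * y ^ 3 + 3 * x * y * z
        + 2 * √(y ^ 6 + 3 * x * z * y ^ 4 + 3 * x ^ 2 * z ^ 2 * y ^ 2 + x ^ 3 * z ^ 3))
        / x ^ 2 := by
  have hz : z = Q * y ^ 2 / x := by rw [← hxz]; field_simp
  have hw : w = Q' * Q ^ 2 * y ^ 3 / x ^ 2 := by
    have : w = Q' * z ^ 2 / y := by rw [← hyw]; field_simp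
    rw [this, hz]
    field_simp
  have hsqrt : √(y ^ 6 + 3 * x * z * y ^ 4 + 3 * x ^ 2 * z ^ 2 * y ^ 2 + x ^ 3 * z ^ 3)
      = √(Q + 1) ^ 3 * y ^ 3 := by
    rw [Real.sqrt_eq_iff_mul_self_eq_of_pos (by positivity)]
    have h : √(Q + 1) ^ 2 = Q + 1 := Real.sq_sqrt (by positivity)
    calc √(Q + 1) ^ 3 * y ^ 3 * (√(Q + 1) ^ 3 * y ^ 3) = (√(Q + 1) ^ 2) ^ 3 * y ^ 6 := by ring
      _ = y ^ 6 + 3 * (x * z) * y ^ 4 + 3 * (x * z) ^ 2 * y ^ 2 + (x * z) ^ 3 := by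
        rw [h, hxz]; ring
      _ = _ := by ring
  rw [hsqrt, hw, hQQ']
  congr 1
  linear_combination (-3 * y) * hxz

/-- The relation between consecutive ratios in the isotropic recurrence is symmetric. -/
theorem isotropic_ratio_symm {R S : ℝ} (hR : 0 < R)
    (hS : S * R ^ 2 = 2 + 3 * R + 2 * √(R + 1) ^ 3) :
    R * S ^ 2 = 2 + 3 * S + 2 * √(S + 1) ^ 3 := by
  set u := √(R + 1) with hu
  have hu2 : u ^ 2 = R + 1 := Real.sq_sqrt (by positivity)
  have hu1 : 1 < u := Real.lt_sqrt_of_sq_lt (by linarith)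
  have hne : 0 < u - 1 := by linarith
  have hRu : R = (u - 1) * (u + 1) := by linear_combination -hu2
  have hSu : S = (2 * u - 1) / (u - 1) ^ 2 := by
    rw [eq_div_iff (by positivity)]
    have : (u + 1) ^ 2 ≠ 0 := by positivity
    apply mul_right_cancel₀ this
    rw [hRu] at hS
    linear_combination hS
  have hv : √(S + 1) = u / (u - 1) := by
    rw [Real.sqrt_eq_iff_mul_self_eq_of_pos (by positivity), hSu]
    field_simp
    ring
  rw [hv, hSu, hRu]
  field_simp
  ring

theorem kashaev_isotropic_solution (a b c : ℝ) (ha : 0 < a) (hb : 0 < b) (hc : 0 < c)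
    (R S : ℝ) (hR : R = a * c / b ^ 2)
    (hS : S = (2 * (R + 1) ^ ((3 : ℝ) / 2) + 3 * R + 2) / R ^ 2)
    (f : ℕ → ℝ)
    (hf : ∀ n : ℕ, f n = a ^ ((1 : ℤ) - n) * b ^ n * R ^ (n ^ 2 / 4) * S ^ ((n - 1) ^ 2 / 4)) :
    f 0 = a ∧ f 1 = b ∧ f 2 = c ∧
      ∀ n : ℕ, f (n + 3) =
        (2 * f (n + 1) ^ 3 + 3 * f n * f (n + 1) * f (n + 2)
          + 2 * Real.sqrt (f (n + 1) ^ 6 + 3 * f n * f (n + 2) * f (n + 1) ^ 4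
              + 3 * f n ^ 2 * f (n + 2) ^ 2 * f (n + 1) ^ 2 + f n ^ 3 * f (n + 2) ^ 3))
          / f n ^ 2 := by
  have hR0 : 0 < R := by rw [hR]; positivity
  have hS0 : 0 < S := by rw [hS]; positivity
  have hfpos (n : ℕ) : 0 < f n := by rw [hf]; positivity
  have hSR : S * R ^ 2 = 2 + 3 * R + 2 * √(R + 1) ^ 3 := by
    have h : (R + 1) ^ ((3 : ℝ) / 2) = √(R + 1) ^ 3 := by
      rw [Real.sqrt_eq_rpow, ← Real.rpow_mul_natCast (by positivity)]
      norm_num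
    rw [hS, h]
    field_simp
    ring
  have hRS := isotropic_ratio_symm hR0 hSR
  have hratio (n : ℕ) {i j : ℕ}
      (hi : n ^ 2 / 4 + (n + 2) ^ 2 / 4 = 2 * ((n + 1) ^ 2 / 4) + i)
      (hj : (n - 1) ^ 2 / 4 + (n + 1) ^ 2 / 4 = 2 * (n ^ 2 / 4) + j) :
      f n * f (n + 2) = R ^ i * S ^ j * f (n + 1) ^ 2 := by
    have h := zpow_one_sub_mul_pow_mul_eq_sq ha.ne' b n
    have hRi := congrArg (R ^ ·) hi
    have hSj := congrArg (S ^ ·) hj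
    simp only [pow_add, pow_mul'] at hRi hSj
    rw [hf, hf, hf, show n + 2 - 1 = n + 1 by omega, Nat.add_sub_cancel]
    calc _ = ((a ^ ((1 : ℤ) - n) * b ^ n) * (a ^ ((1 : ℤ) - (n + 2 : ℕ)) * b ^ (n + 2)))
          * (R ^ (n ^ 2 / 4) * R ^ ((n + 2) ^ 2 / 4))
          * (S ^ ((n - 1) ^ 2 / 4) * S ^ ((n + 1) ^ 2 / 4)) := by ring
      _ = _ := by rw [h, hRi, hSj]; ring
  have heven (n : ℕ) (hn : Even n) : f n * f (n + 2) = R * f (n + 1) ^ 2 := by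
    have hj : (n - 1) ^ 2 / 4 + (n + 1) ^ 2 / 4 = 2 * (n ^ 2 / 4) + 0 := by
      rcases n with _ | m
      · rfl
      · exact sq_div_four_add_of_odd (by grind)
    simpa using hratio n (sq_div_four_add_of_even hn) hj
  have hodd (n : ℕ) (hn : Odd n) : f n * f (n + 2) = S * f (n + 1) ^ 2 := by
    have hj : (n - 1) ^ 2 / 4 + (n + 1) ^ 2 / 4 = 2 * (n ^ 2 / 4) + 1 := by
      obtain ⟨k, rfl⟩ := hn
      exact sq_div_four_add_of_even (even_two_mul k)
    simpa using hratio n (i := 0) (sq_div_four_add_of_odd hn) hj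
  refine ⟨by simp [hf], by simp [hf], ?_, fun n ↦ ?_⟩
  · rw [hf, hR]
    norm_num [zpow_neg]
    field_simp
  · rcases Nat.even_or_odd n with hn | hn
    · exact isotropic_step (hfpos n) (hfpos _) hR0 (heven n hn) (hodd (n + 1) hn.add_one) hSR
    · exact isotropic_step (hfpos n) (hfpos _) hS0 (hodd n hn) (heven (n + 1) hn.add_one) hRS
end
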